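/- arXiv:1801.06555 — 3 statements merged into one kernel-verified Lean document; each statement's English description precedes it below -/
import Mathlib

section
/- Let $K$ be a field and let $\alpha, \beta \in K^{\times}$ be nonzero elements. Let $\widetilde{A} = \begin{pmatrix} \alpha & 1 \\ 0 & 1 \end{pmatrix}$ and $\widetilde{B} = \begin{pmatrix} 1 & 0 \\ 0 & \beta \end{pmatrix}$ in $\mathrm{GL}(2,K)$, and let $H$ be the subgroup of $\mathrm{GL}(2,K)$ generated by $\widetilde{A}$ and $\widetilde{B}$. Then the commutator subgroup of $H$ is exactly the set $\Big\{ \begin{pmatrix} 1 & n \\ 0 & 1 \end{pmatrix} : n \in M \Big\}$, where $M$ is the additive subgroup of $K$ generated by the elements $\alpha^{i} \beta^{j} (1 - \beta^{-1})$ for $i, j \in \mathbb{Z}$. -/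
open scoped commutatorElement

theorem Subgroup.commutator_closure_le_of_le_normalizer {G : Type*} [Group G] {S : Set G}
    {N : Subgroup G} (hN : S ⊆ Subgroup.normalizer (N : Set G))
    (hS : ∀ a ∈ S, ∀ b ∈ S, ⁅a, b⁆ ∈ N) :
    ⁅Subgroup.closure S, Subgroup.closure S⁆ ≤ N := by
  have hconj := Subgroup.le_normalizer_iff.1 ((Subgroup.closure_le _).2 hN)
  have hconj' : ∀ g ∈ Subgroup.closure S, ∀ n ∈ N, g⁻¹ * n * g ∈ N := fun g hg n hn => by
    simpa using hconj g⁻¹ (inv_mem hg) n hn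
  have hcomm : ∀ {a b : G}, ⁅a, b⁆ ∈ N → ⁅b, a⁆ ∈ N := fun {a b} h => by
    simpa using N.inv_mem h
  refine Subgroup.commutator_le.2 fun x hx y hy => ?_
  induction hx, hy using Subgroup.closure_induction₂ with
  | mem a b ha hb => exact hS a ha b hb
  | one_left => simp
  | one_right => simp
  | mul_left a b c ha hb hc hac hbc =>
    rw [commutatorElement_mul_left_eq_conj_mul]
    exact mul_mem (hconj a ha _ hbc) hac
  | mul_right b c a hb hc ha hab hac =>
    rw [commutatorElement_mul_right_eq_mul_conj, mul_assoc, mul_assoc, ← mul_assoc b]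
    exact mul_mem hab (hconj b hb _ hac)
  | inv_left a b ha hb hab =>
    rw [commutatorElement_inv_left]
    exact hconj' a ha _ (hcomm hab)
  | inv_right a b ha hb hab =>
    rw [commutatorElement_inv_right]
    exact hconj' b hb _ (hcomm hab)

namespace Matrix.GeneralLinearGroup

variable {K : Type*} [Field K]

theorem conj_zpow_upperRightHom {g : GL (Fin 2) K} {c : K} (hc : c ≠ 0)
    (h : ∀ n, g * upperRightHom n * g⁻¹ = upperRightHom (c * n)) (k : ℤ) (n : K) :
    g ^ k * upperRightHom n * (g ^ k)⁻¹ = upperRightHom (c ^ k * n) := by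
  induction k generalizing n with
  | zero => simp
  | succ k ih =>
    have := ih (c * n)
    rw [← h n] at this
    rw [_root_.zpow_add_one, zpow_add_one₀ hc, mul_assoc (c ^ (k : ℤ)), ← this]
    group
  | pred k ih =>
    have := ih (c⁻¹ * n)
    have hn : upperRightHom (c⁻¹ * n) = g⁻¹ * upperRightHom n * g := by
      rw [← mul_inv_cancel_left₀ hc n, ← h (c⁻¹ * n), mul_inv_cancel_left₀ hc n]
      group
    rw [hn] at this
    rw [_root_.zpow_sub_one, zpow_sub_one₀ hc, mul_assoc (c ^ (-k : ℤ)), ← this]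
    group

/-- The unipotent upper triangular matrices with upper right entry in `M`. -/
def upperRightSubgroup (M : AddSubgroup K) : Subgroup (GL (Fin 2) K) :=
  (AddSubgroup.toSubgroup M).map (upperRightHom (R := K)).toMonoidHom

theorem mem_upperRightSubgroup {M : AddSubgroup K} {x : GL (Fin 2) K} :
    x ∈ upperRightSubgroup M ↔ ∃ n ∈ M, upperRightHom n = x :=
  Iff.rfl

theorem mem_normalizer_upperRightSubgroup {M : AddSubgroup K} {g : GL (Fin 2) K} {c : K}
    (hc : c ≠ 0) (h : ∀ n, g * upperRightHom n * g⁻¹ = upperRightHom (c * n))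
    (hM : ∀ k : ℤ, ∀ n ∈ M, c ^ k * n ∈ M) :
    g ∈ Subgroup.normalizer (upperRightSubgroup M : Set (GL (Fin 2) K)) := by
  suffices Subgroup.zpowers g ≤ Subgroup.normalizer (upperRightSubgroup M : Set (GL (Fin 2) K))
    from this (Subgroup.mem_zpowers g)
  rw [Subgroup.le_normalizer_iff]
  rintro _ ⟨k, rfl⟩ _ ⟨n, hn, rfl⟩
  exact mem_upperRightSubgroup.2 ⟨_, hM k n hn, (conj_zpow_upperRightHom hc h k n).symm⟩

theorem conj_upperRightHom {g : GL (Fin 2) K} {a b d : K} (hd : d ≠ 0)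
    (hg : (g : Matrix (Fin 2) (Fin 2) K) = !![a, b; 0, d]) (n : K) :
    g * upperRightHom n * g⁻¹ = upperRightHom (a * d⁻¹ * n) := by
  rw [mul_inv_eq_iff_eq_mul]
  ext i j
  fin_cases i <;> fin_cases j <;> simp [hg]
  field_simp
  ring

end Matrix.GeneralLinearGroup

open Matrix.GeneralLinearGroup

/-- Let `K` be a field, `α β ∈ Kˣ`, and let `H ≤ GL(2,K)` be the subgroup generated by
`Ã = !![α, 1; 0, 1]` and `B̃ = !![1, 0; 0, β]`. Then the commutator subgroup `[H,H]` is
exactly the set of matrices `!![1, n; 0, 1]` with `n` ranging over the additive subgroup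
of `K` generated by the elements `α^i * β^j * (1 - β⁻¹)`, `i j ∈ ℤ`. -/
theorem commutator_of_special_subgroup_eq
    {K : Type*} [Field K] (α β : K) (hα : α ≠ 0) (hβ : β ≠ 0)
    (A B : GL (Fin 2) K)
    (hA : (A : Matrix (Fin 2) (Fin 2) K) = !![α, 1; 0, 1])
    (hB : (B : Matrix (Fin 2) (Fin 2) K) = !![1, 0; 0, β]) :
    ∀ x : GL (Fin 2) K,
      x ∈ (⁅Subgroup.closure {A, B}, Subgroup.closure {A, B}⁆ :
          Subgroup (GL (Fin 2) K)) ↔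
        ∃ n ∈ AddSubgroup.closure
            {m : K | ∃ i j : ℤ, m = α ^ i * β ^ j * (1 - β⁻¹)},
          (x : Matrix (Fin 2) (Fin 2) K) = !![1, n; 0, 1] := by
  have hAc : ∀ n, A * upperRightHom n * A⁻¹ = upperRightHom (α * n) := by
    simpa using conj_upperRightHom one_ne_zero hA
  have hBc : ∀ n, B * upperRightHom n * B⁻¹ = upperRightHom (β⁻¹ * n) := by
    simpa using conj_upperRightHom hβ hB
  have hAB : ⁅A, B⁆ = upperRightHom (1 - β⁻¹) := by
    rw [commutatorElement_def, mul_inv_eq_iff_eq_mul, mul_inv_eq_iff_eq_mul]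
    ext i j
    fin_cases i <;> fin_cases j <;> simp [hA, hB]
    field_simp
    ring
  set M := AddSubgroup.closure {m : K | ∃ i j : ℤ, m = α ^ i * β ^ j * (1 - β⁻¹)} with hM
  have hmul : ∀ k l : ℤ, ∀ n ∈ M, α ^ k * β ^ l * n ∈ M := fun k l n hn => by
    induction hn using AddSubgroup.closure_induction with
    | mem _ h =>
      obtain ⟨i, j, rfl⟩ := h
      refine AddSubgroup.subset_closure ⟨k + i, l + j, ?_⟩
      rw [zpow_add₀ hα, zpow_add₀ hβ]
      ring
    | zero => simp
    | add _ _ _ _ h₁ h₂ => simpa [mul_add] using add_mem h₁ h₂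
    | neg _ _ h => simpa using h
  have hABN : ⁅A, B⁆ ∈ upperRightSubgroup M :=
    mem_upperRightSubgroup.2 ⟨1 - β⁻¹, AddSubgroup.subset_closure ⟨0, 0, by simp⟩, hAB.symm⟩
  set C := ⁅Subgroup.closure {A, B}, Subgroup.closure {A, B}⁆
  have hAmem : A ∈ Subgroup.closure {A, B} := Subgroup.subset_closure (by simp)
  have hBmem : B ∈ Subgroup.closure {A, B} := Subgroup.subset_closure (by simp)
  have hle : C ≤ upperRightSubgroup M := by
    refine Subgroup.commutator_closure_le_of_le_normalizer ?_ ?_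
    · rintro _ (rfl | rfl)
      · exact mem_normalizer_upperRightSubgroup hα hAc fun k n hn => by
          simpa using hmul k 0 n hn
      · exact mem_normalizer_upperRightSubgroup (inv_ne_zero hβ) hBc fun k n hn => by
          simpa using hmul 0 (-k) n hn
    · rintro _ (rfl | rfl) _ (rfl | rfl)
      · simp
      · exact hABN
      · simpa using inv_mem hABN
      · simp
  have hge : M ≤ C.strictPeriods := by
    rw [hM, AddSubgroup.closure_le]
    rintro _ ⟨i, j, rfl⟩
    have hj := conj_zpow_upperRightHom (inv_ne_zero hβ) hBc (-j) (1 - β⁻¹)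
    have hi := conj_zpow_upperRightHom hα hAc i (β⁻¹ ^ (-j) * (1 - β⁻¹))
    rw [← hj, ← hAB, conjugate_commutatorElement, conjugate_commutatorElement] at hi
    have hconj : ∀ g ∈ Subgroup.closure {A, B}, ∀ x ∈ Subgroup.closure {A, B},
        g * x * g⁻¹ ∈ Subgroup.closure {A, B} := fun g hg x hx =>
      mul_mem (mul_mem hg hx) (inv_mem hg)
    rw [SetLike.mem_coe, Subgroup.mem_strictPeriods_iff,
      show α ^ i * β ^ j * (1 - β⁻¹) = α ^ i * (β⁻¹ ^ (-j) * (1 - β⁻¹)) by simp [mul_assoc], ← hi]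
    have hAi := zpow_mem hAmem i
    have hBj := zpow_mem hBmem (-j)
    exact Subgroup.commutator_mem_commutator (hconj _ hAi _ (hconj _ hBj _ hAmem))
      (hconj _ hAi _ (hconj _ hBj _ hBmem))
  intro x
  constructor
  · intro hx
    obtain ⟨n, hn, rfl⟩ := mem_upperRightSubgroup.1 (hle hx)
    exact ⟨n, hn, rfl⟩
  · rintro ⟨n, hn, hx⟩
    rw [show x = upperRightHom n from Units.ext hx]
    exact Subgroup.mem_strictPeriods_iff.1 (hge hn)
end

section
/- Let $K$ be a field and let $\alpha, \beta \in K^{\times}$ be nonzero elements which are algebraically independent over the prime subfield of $K$. Then the additive subgroup $M$ of $K$ generated by the elements $\alpha^{i} \beta^{j} (1 - \beta^{-1})$, $i, j \in \mathbb{Z}$, is not finitely generated as an abelian group. -/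
/-- Let `K` be a field and `α, β ∈ Kˣ` algebraically independent over the prime subfield
`⊥ : Subfield K`. Then the additive subgroup of `K` generated by the elements
`α^i * β^j * (1 - β⁻¹)`, `i j ∈ ℤ`, is not finitely generated. -/
theorem addSubgroup_not_fg_of_algebraicIndependent
    {K : Type*} [Field K] (α β : K) (hα : α ≠ 0) (hβ : β ≠ 0)
    (hind : AlgebraicIndependent (⊥ : Subfield K) ![α, β]) :
    ¬ (AddSubgroup.closure
        {m : K | ∃ i j : ℤ, m = α ^ i * β ^ j * (1 - β⁻¹)}).FG := by
  intro hfg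
  have hαt : Transcendental (⊥ : Subfield K) α := by simpa using hind.transcendental 0
  have hβt : Transcendental (⊥ : Subfield K) β := by simpa using hind.transcendental 1
  have hβ1 : β ≠ 1 := fun h => hβt (h ▸ isAlgebraic_one)
  set M := AddSubgroup.closure {m : K | ∃ i j : ℤ, m = α ^ i * β ^ j * (1 - β⁻¹)}
  have hne : 1 - β⁻¹ ≠ 0 := by
    rw [sub_ne_zero, ne_comm, Ne, inv_eq_one]
    exact hβ1
  have hmem : 1 - β⁻¹ ∈ M := AddSubgroup.subset_closure ⟨0, 0, by simp⟩
  have hmul : ∀ n ∈ M, α * n ∈ M := by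
    intro n hn
    induction hn using AddSubgroup.closure_induction with
    | mem x hx =>
      obtain ⟨i, j, rfl⟩ := hx
      exact AddSubgroup.subset_closure ⟨i + 1, j, by rw [zpow_add_one₀ hα]; ring⟩
    | zero => simp
    | add x y _ _ hx hy => simpa [mul_add] using M.add_mem hx hy
    | neg x _ hx => simpa using M.neg_mem hx
  have hint : IsIntegral ℤ α :=
    isIntegral_of_smul_mem_submodule (AddSubgroup.toIntSubmodule M)
      (fun h => hne <| by simpa [h] using
        (show 1 - β⁻¹ ∈ AddSubgroup.toIntSubmodule M from hmem))
      ((Submodule.fg_iff_addSubgroup_fg _).2 hfg) α hmul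
  exact hαt (hint.tower_top (A := (⊥ : Subfield K))).isAlgebraic
end

section
/- Let $K$ be a field and let $\alpha, \beta \in K^{\times}$ be nonzero elements which are algebraically independent over the prime subfield of $K$. Let $\widetilde{A} = \begin{pmatrix} \alpha & 1 \\ 0 & 1 \end{pmatrix}$ and $\widetilde{B} = \begin{pmatrix} 1 & 0 \\ 0 & \beta \end{pmatrix}$ in $\mathrm{GL}(2,K)$, and let $H$ be the subgroup of $\mathrm{GL}(2,K)$ generated by $\widetilde{A}$ and $\widetilde{B}$. Then $H$ is a finitely generated solvable group (indeed its second derived subgroup is trivial), but its commutator subgroup $[H,H]$ is not finitely generated as a group. -/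
section

open Matrix Matrix.GeneralLinearGroup
open scoped commutatorElement

/-- The subgroup of upper triangular matrices in `GL (Fin 2) K`. -/
def upperTriangularGL (K : Type*) [Field K] : Subgroup (GL (Fin 2) K) where
  carrier := {g | g 1 0 = 0}
  one_mem' := by simp
  mul_mem' {a b} ha hb := by
    simp only [Set.mem_ofPred_eq] at ha hb ⊢
    simp [Matrix.mul_apply, ha, hb]
  inv_mem' {a} ha := by
    simp only [Set.mem_ofPred_eq] at ha ⊢
    simp [Matrix.inv_def, Matrix.adjugate_fin_two, ha]

variable {K : Type*} [Field K]

lemma mem_upperTriangularGL {g : GL (Fin 2) K} : g ∈ upperTriangularGL K ↔ g 1 0 = 0 := Iff.rfl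

lemma exists_upperRightHom_eq_commutatorElement {g h : GL (Fin 2) K}
    (hg : g ∈ upperTriangularGL K) (hh : h ∈ upperTriangularGL K) :
    ∃ x, upperRightHom x = ⁅g, h⁆ := by
  have hg0 : g 0 0 * g 1 1 ≠ 0 := by
    simpa [Matrix.det_fin_two, mem_upperTriangularGL.1 hg] using g.det.ne_zero
  have hh0 : h 0 0 * h 1 1 ≠ 0 := by
    simpa [Matrix.det_fin_two, mem_upperTriangularGL.1 hh] using h.det.ne_zero
  have hd : g 1 1 * h 1 1 ≠ 0 := mul_ne_zero (right_ne_zero_of_mul hg0) (right_ne_zero_of_mul hh0)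
  rw [mem_upperTriangularGL] at hg hh
  refine ⟨((g * h) 0 1 - (h * g) 0 1) / (g 1 1 * h 1 1), ?_⟩
  have key : upperRightHom (((g * h) 0 1 - (h * g) 0 1) / (g 1 1 * h 1 1)) * (h * g) = g * h := by
    ext i j
    fin_cases i <;> fin_cases j <;>
      simp [Matrix.mul_apply, hg, hh, mul_comm]
    rw [mul_div_cancel₀ _ hd, add_sub_cancel]
  rw [eq_mul_inv_of_mul_eq key, commutatorElement_def, _root_.mul_inv_rev, mul_assoc (g * h)]

lemma commutator_coe_subset_range_upperRightHom {H : Subgroup (GL (Fin 2) K)}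
    (hH : H ≤ upperTriangularGL K) :
    ((⁅H, H⁆ : Subgroup (GL (Fin 2) K)) : Set (GL (Fin 2) K)) ⊆ Set.range upperRightHom := by
  have : ⁅H, H⁆ ≤ (upperRightHom (R := K)).toMonoidHom.range :=
    Subgroup.commutator_le.2 fun g hg h hh ↦
      exists_upperRightHom_eq_commutatorElement (K := K) (hH hg) (hH hh)
  exact this

lemma commutator_commutator_eq_bot {H : Subgroup (GL (Fin 2) K)}
    (hH : H ≤ upperTriangularGL K) : ⁅⁅H, H⁆, ⁅H, H⁆⁆ = ⊥ := by
  rw [eq_bot_iff, Subgroup.commutator_le]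
  intro g hg h hh
  obtain ⟨x, rfl⟩ := commutator_coe_subset_range_upperRightHom hH hg
  obtain ⟨y, rfl⟩ := commutator_coe_subset_range_upperRightHom hH hh
  rw [Subgroup.mem_bot, commutatorElement_eq_one_iff_mul_comm, ← AddChar.map_add_eq_mul,
    ← AddChar.map_add_eq_mul, add_comm]

/-- A subgroup of unipotent upper triangular matrices is finitely generated only if the additive
group of its upper right entries is. -/
lemma fg_strictPeriods {N : Subgroup (GL (Fin 2) K)}
    (hN : (N : Set (GL (Fin 2) K)) ⊆ Set.range upperRightHom) (hfg : N.FG) : N.strictPeriods.FG := by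
  rw [Subgroup.fg_iff_add_fg, AddSubgroup.fg_iff_addSubmonoid_fg] at hfg
  rw [AddSubgroup.fg_iff_addSubmonoid_fg]
  refine AddSubmonoid.FG.map_injective (upperRightHom (R := K)).toAddMonoidHom
    injective_upperRightHom ?_
  convert! hfg
  refine le_antisymm ?_ fun g hg ↦ ?_
  · rintro _ ⟨x, hx, rfl⟩
    exact hx
  · obtain ⟨x, hx⟩ := hN hg
    refine ⟨x, ?_, hx⟩
    change upperRightHom x ∈ N
    rw [hx]
    exact hg

lemma mul_upperRightHom_mul_inv {g : GL (Fin 2) K} {a b : K}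
    (hg : (g : Matrix (Fin 2) (Fin 2) K) = !![a, b; 0, 1]) (x : K) :
    g * upperRightHom x * g⁻¹ = upperRightHom (a * x) := by
  rw [mul_inv_eq_iff_eq_mul]
  ext i j
  fin_cases i <;> fin_cases j <;> simp [hg, add_comm]

/-- If the commutator subgroup of an upper triangular group `H` is nontrivial and finitely
generated, then every `a` such that `!![a, b; 0, 1]` lies in `H` for some `b` is integral
over `ℤ`. -/
lemma isIntegral_of_commutator_fg {H : Subgroup (GL (Fin 2) K)} (hH : H ≤ upperTriangularGL K)
    (hne : ⁅H, H⁆ ≠ ⊥) (hfg : (⁅H, H⁆ : Subgroup (GL (Fin 2) K)).FG) {g : GL (Fin 2) K}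
    (hgH : g ∈ H) {a b : K} (hg : (g : Matrix (Fin 2) (Fin 2) K) = !![a, b; 0, 1]) :
    IsIntegral ℤ a := by
  have hsub := commutator_coe_subset_range_upperRightHom hH
  refine isIntegral_of_smul_mem_submodule
    (AddSubgroup.toIntSubmodule (Subgroup.strictPeriods ⁅H, H⁆)) ?_ ?_ a fun x hx ↦ ?_
  · obtain ⟨⟨u, hu⟩, hu1⟩ := Subgroup.ne_bot_iff_exists_ne_one.1 hne
    obtain ⟨x, rfl⟩ := hsub hu
    refine (Submodule.ne_bot_iff _).2 ⟨x, hu, ?_⟩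
    rintro rfl
    exact hu1 (Subtype.ext (AddChar.map_zero_eq_one _))
  · rw [Submodule.fg_iff_addSubgroup_fg]
    exact fg_strictPeriods hsub hfg
  · change upperRightHom (a * x) ∈ ⁅H, H⁆
    rw [← mul_upperRightHom_mul_inv hg]
    have hconj := Subgroup.mul_mem _ (Subgroup.commutator_mem_commutator hgH
      (Subgroup.commutator_le_self H hx)) hx
    rwa [commutatorElement_def, inv_mul_cancel_right] at hconj

lemma isSolvable_of_commutator_commutator_eq_bot {G : Type*} [Group G] {H : Subgroup G}
    (h : ⁅⁅H, H⁆, ⁅H, H⁆⁆ = ⊥) : Group.IsSolvable H := by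
  refine ⟨⟨2, (Subgroup.map_eq_bot_iff_of_injective _ H.subtype_injective).1 ?_⟩⟩
  rw [derivedSeries_succ, derivedSeries_one, Subgroup.map_commutator,
    Subgroup.map_subtype_commutator, h]

end

/-- Let `K` be a field and `α, β ∈ Kˣ` algebraically independent over the prime subfield
`⊥ : Subfield K`. Let `H ≤ GL(2,K)` be the subgroup generated by `Ã = !![α, 1; 0, 1]` and
`B̃ = !![1, 0; 0, β]`. Then `H` is a finitely generated solvable group — indeed its second
derived subgroup is trivial — but its commutator subgroup `[H,H]` is not finitely
generated. -/
theorem fg_solvable_group_with_non_fg_commutator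
    {K : Type*} [Field K] (α β : K) (hα : α ≠ 0) (hβ : β ≠ 0)
    (hind : AlgebraicIndependent (⊥ : Subfield K) ![α, β])
    (A B : GL (Fin 2) K)
    (hA : (A : Matrix (Fin 2) (Fin 2) K) = !![α, 1; 0, 1])
    (hB : (B : Matrix (Fin 2) (Fin 2) K) = !![1, 0; 0, β]) :
    (Subgroup.closure {A, B} : Subgroup (GL (Fin 2) K)).FG ∧
    IsSolvable (Subgroup.closure {A, B} : Subgroup (GL (Fin 2) K)) ∧
    (⁅(⁅Subgroup.closure {A, B}, Subgroup.closure {A, B}⁆ : Subgroup (GL (Fin 2) K)),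
        (⁅Subgroup.closure {A, B}, Subgroup.closure {A, B}⁆ : Subgroup (GL (Fin 2) K))⁆ :
      Subgroup (GL (Fin 2) K)) = ⊥ ∧
    ¬ (⁅Subgroup.closure {A, B}, Subgroup.closure {A, B}⁆ :
        Subgroup (GL (Fin 2) K)).FG := by
  have hα' : Transcendental (⊥ : Subfield K) α := hind.transcendental 0
  have hβ' : Transcendental (⊥ : Subfield K) β := hind.transcendental 1
  have hβ1 : β ≠ 1 := by
    rintro rfl
    exact hβ' isAlgebraic_one
  have hH : Subgroup.closure {A, B} ≤ upperTriangularGL K := by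
    rw [Subgroup.closure_le, Set.insert_subset_iff, Set.singleton_subset_iff]
    exact ⟨mem_upperTriangularGL.2 (by simp [hA]), mem_upperTriangularGL.2 (by simp [hB])⟩
  have hAH : A ∈ Subgroup.closure {A, B} := Subgroup.subset_closure (by simp)
  have hBH : B ∈ Subgroup.closure {A, B} := Subgroup.subset_closure (by simp)
  have hne : ⁅Subgroup.closure {A, B}, Subgroup.closure {A, B}⁆ ≠ ⊥ := fun h ↦ by
    have hAB := h ▸ Subgroup.commutator_mem_commutator hAH hBH
    rw [Subgroup.mem_bot, commutatorElement_eq_one_iff_mul_comm] at hAB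
    have h01 := congr_arg (fun g : GL (Fin 2) K ↦ g 0 1) hAB
    exact hβ1 (by simpa [hA, hB] using h01)
  refine ⟨(Subgroup.fg_iff _).2 ⟨_, rfl, by simp⟩, isSolvable_of_commutator_commutator_eq_bot
    (commutator_commutator_eq_bot hH), commutator_commutator_eq_bot hH, fun hfg ↦ ?_⟩
  exact hα' (isIntegral_of_commutator_fg hH hne hfg hAH hA).tower_top.isAlgebraic
end
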